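/- Fix a positive rational number γ and let z_γ ∈ (0,1) be the unique solution of l_γ'(z) = 0. Then, as d → ∞ along positive integers d such that γd is an integer, N₂(d,γ) · (z_γ^γ / h(z_γ))^d · h(z_γ) z_γ (1 − z_γ) (2 l_γ''(z_γ) π d)^{1/2} → 1; equivalently, N₂(d,γ) = (h(z_γ)/z_γ^γ)^d · (1 + o(1)) / ( h(z_γ) z_γ (1 − z_γ) (2 l_γ''(z_γ) π d)^{1/2} ). -/

import Mathlib

open Real Set Filter

/-- The Jacobi theta function `h(z) = Σ_{r ∈ ℤ} z^{r²}` for real `0 < z < 1`. -/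
noncomputable def jacobiH (z : ℝ) : ℝ := ∑' r : ℤ, z ^ (r ^ 2).toNat

/-- `l_γ(z) = log h(z) − γ log z`. -/
noncomputable def lgam (γ : ℝ) (z : ℝ) : ℝ := Real.log (jacobiH z) - γ * Real.log z

/-- `N₁(d,γ) = #{k ∈ ℤ^d : k₁² + … + k_d² ≤ γ d}`. -/
noncomputable def N1 (d : ℕ) (γ : ℝ) : ℕ :=
  Set.ncard {k : Fin d → ℤ | (∑ i, ((k i : ℝ)) ^ 2) ≤ γ * d}

/-- The filter of `d → ∞` along positive integers `d` such that `γ d` is an integer. -/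
def alongIntMultiples (γ : ℚ) : Filter ℕ :=
  Filter.atTop ⊓ Filter.principal {d : ℕ | ∃ m : ℤ, (γ : ℝ) * d = (m : ℝ)}

/-- `N₂(d,γ) = #{k ∈ ℤ^d : k₁ = 0 and k₂² + … + k_d² ≤ γ d}` (the first coordinate,
i.e. the coordinate of index `0`, vanishes). -/
noncomputable def N2 (d : ℕ) (γ : ℝ) : ℕ :=
  Set.ncard {k : Fin d → ℤ |
    (∀ i : Fin d, (i : ℕ) = 0 → k i = 0) ∧ (∑ i, ((k i : ℝ)) ^ 2) ≤ γ * d}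

open MeasureTheory ProbabilityTheory Topology

section ThetaMeasure

variable {z : ℝ}

lemma summable_theta (h0 : 0 ≤ z) (h1 : z < 1) :
    Summable fun r : ℤ => z ^ (r ^ 2).toNat := by
  have hnat : Summable fun n : ℕ => z ^ (n ^ 2) :=
    (summable_geometric_of_lt_one h0 h1).of_nonneg_of_le (fun n => pow_nonneg h0 _)
      fun n => pow_le_pow_of_le_one h0 h1.le (Nat.le_self_pow two_ne_zero n)
  have hcast (n : ℕ) : (((n : ℤ) ^ 2).toNat) = n ^ 2 := by
    rw [← Nat.cast_pow, Int.toNat_natCast]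
  refine summable_int_iff_summable_nat_and_neg.2 ⟨?_, ?_⟩
  · simpa only [hcast] using hnat
  · simpa only [neg_sq, hcast] using hnat

lemma jacobiH_pos (h0 : 0 ≤ z) (h1 : z < 1) : 0 < jacobiH z :=
  (summable_theta h0 h1).tsum_pos (fun r => pow_nonneg h0 _) 0 (by simp)

/-- The probability weight `z ^ r² / h(z)` of the integer `r`. -/
noncomputable def thetaWeight (z : ℝ) (r : ℤ) : ℝ := z ^ (r ^ 2).toNat / jacobiH z

/-- The discrete Gaussian measure on `ℤ`, giving mass `z ^ r² / h(z)` to `r`. -/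
noncomputable def thetaMeasure (z : ℝ) : Measure ℤ :=
  Measure.count.withDensity fun r => ENNReal.ofReal (thetaWeight z r)

lemma thetaWeight_nonneg (h0 : 0 ≤ z) (h1 : z < 1) (r : ℤ) : 0 ≤ thetaWeight z r :=
  div_nonneg (pow_nonneg h0 _) (jacobiH_pos h0 h1).le

lemma hasSum_thetaWeight (h0 : 0 ≤ z) (h1 : z < 1) : HasSum (thetaWeight z) 1 := by
  have := (summable_theta h0 h1).hasSum.div_const (jacobiH z)
  rwa [← jacobiH, div_self (jacobiH_pos h0 h1).ne'] at this

lemma thetaMeasure_real_singleton (h0 : 0 ≤ z) (h1 : z < 1) (r : ℤ) :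
    (thetaMeasure z).real {r} = thetaWeight z r := by
  simp [thetaMeasure, Measure.real, withDensity_apply, thetaWeight_nonneg h0 h1]

lemma isProbabilityMeasure_thetaMeasure (h0 : 0 ≤ z) (h1 : z < 1) :
    IsProbabilityMeasure (thetaMeasure z) := by
  constructor
  rw [thetaMeasure, withDensity_apply _ MeasurableSet.univ, Measure.restrict_univ, lintegral_count,
    ← ENNReal.ofReal_tsum_of_nonneg (thetaWeight_nonneg h0 h1) (hasSum_thetaWeight h0 h1).summable,
    (hasSum_thetaWeight h0 h1).tsum_eq, ENNReal.ofReal_one]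

lemma integrable_thetaMeasure_iff (h0 : 0 ≤ z) (h1 : z < 1) {f : ℤ → ℝ} :
    Integrable f (thetaMeasure z) ↔ Summable fun r => ‖thetaWeight z r * f r‖ := by
  rw [thetaMeasure, integrable_withDensity_iff_integrable_smul' (by fun_prop) (by simp),
    integrable_count_iff]
  simp [ENNReal.toReal_ofReal (thetaWeight_nonneg h0 h1 _)]

lemma integral_thetaMeasure (h0 : 0 ≤ z) (h1 : z < 1) {f : ℤ → ℝ}
    (hf : Integrable f (thetaMeasure z)) :
    ∫ r, f r ∂thetaMeasure z = ∑' r, thetaWeight z r * f r := by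
  rw [integral_countable hf]
  simp [thetaMeasure_real_singleton h0 h1]

lemma sq_eq_natCast_toNat (r : ℤ) : (r : ℝ) ^ 2 = ((r ^ 2).toNat : ℝ) := by
  exact_mod_cast (congrArg (Int.cast (R := ℝ)) (Int.toNat_of_nonneg (sq_nonneg r))).symm

lemma thetaWeight_mul_exp (γ t : ℝ) (r : ℤ) :
    thetaWeight z r * Real.exp (t * ((r : ℝ) ^ 2 - γ)) =
      (Real.exp (-(t * γ)) / jacobiH z) * (z * Real.exp t) ^ (r ^ 2).toNat := by
  rw [thetaWeight, mul_pow, ← Real.exp_nat_mul, ← sq_eq_natCast_toNat, mul_sub, sub_eq_add_neg, Real.exp_add,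
    mul_comm t ((r : ℝ) ^ 2)]
  ring

lemma integrable_exp_mul_theta (h0 : 0 < z) (h1 : z < 1) (γ : ℝ) {t : ℝ}
    (ht : z * Real.exp t < 1) :
    Integrable (fun r : ℤ => Real.exp (t * ((r : ℝ) ^ 2 - γ))) (thetaMeasure z) := by
  rw [integrable_thetaMeasure_iff h0.le h1]
  simp_rw [thetaWeight_mul_exp]
  exact ((summable_theta (by positivity) ht).mul_left _).norm

lemma mgf_theta (h0 : 0 < z) (h1 : z < 1) (γ : ℝ) {t : ℝ} (ht : z * Real.exp t < 1) :
    mgf (fun r : ℤ => (r : ℝ) ^ 2 - γ) (thetaMeasure z) t =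
      Real.exp (-(t * γ)) / jacobiH z * jacobiH (z * Real.exp t) := by
  rw [mgf, integral_thetaMeasure h0.le h1 (integrable_exp_mul_theta h0 h1 γ ht)]
  simp_rw [thetaWeight_mul_exp, tsum_mul_left]
  rfl

lemma zero_mem_interior_integrableExpSet_theta (h0 : 0 < z) (h1 : z < 1) (γ : ℝ) :
    0 ∈ interior (integrableExpSet (fun r : ℤ => (r : ℝ) ^ 2 - γ) (thetaMeasure z)) := by
  rw [mem_interior_iff_mem_nhds]
  have hc : ContinuousAt (fun t => z * Real.exp t) 0 := by fun_prop
  filter_upwards [hc.eventually_lt (continuousAt_const (y := (1 : ℝ))) (by simpa using h1)]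
    with t ht
  exact integrable_exp_mul_theta h0 h1 γ ht

lemma lgam_eventuallyEq (h0 : 0 < z) (h1 : z < 1) (γ : ℝ) :
    lgam γ =ᶠ[𝓝 z] fun x => lgam γ z +
      cgf (fun r : ℤ => (r : ℝ) ^ 2 - γ) (thetaMeasure z) (Real.log x - Real.log z) := by
  filter_upwards [Ioo_mem_nhds h0 h1] with x hx
  have hzx : z * Real.exp (Real.log x - Real.log z) = x := by
    rw [Real.exp_sub, Real.exp_log hx.1, Real.exp_log h0]
    field_simp
  have hhz := jacobiH_pos h0.le h1
  have hhx := jacobiH_pos hx.1.le hx.2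
  rw [cgf, mgf_theta h0 h1 γ (by rw [hzx]; exact hx.2), hzx, Real.log_mul (by positivity) hhx.ne',
    Real.log_div (by positivity) hhz.ne', Real.log_exp, lgam, lgam]
  ring

lemma deriv_lgam_eventuallyEq (h0 : 0 < z) (h1 : z < 1) (γ : ℝ) :
    deriv (lgam γ) =ᶠ[𝓝 z] fun x =>
      deriv (cgf (fun r : ℤ => (r : ℝ) ^ 2 - γ) (thetaMeasure z))
        (Real.log x - Real.log z) * x⁻¹ := by
  have hc : ContinuousAt (fun x => Real.log x - Real.log z) z :=
    (Real.continuousAt_log h0.ne').sub continuousAt_const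
  have hmem := isOpen_interior.mem_nhds (zero_mem_interior_integrableExpSet_theta h0 h1 γ)
  rw [← sub_self (Real.log z)] at hmem
  filter_upwards [(lgam_eventuallyEq h0 h1 γ).eventuallyEq_nhds, hc.preimage_mem_nhds hmem,
    Ioi_mem_nhds h0] with x hx hx' hx0
  rw [hx.deriv_eq]
  exact (((analyticAt_cgf hx').differentiableAt.hasDerivAt.comp x
    ((Real.hasDerivAt_log (ne_of_gt hx0)).sub_const _)).const_add _).deriv

lemma integral_theta_eq_zero (h0 : 0 < z) (h1 : z < 1) {γ : ℝ} (hz : deriv (lgam γ) z = 0) :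
    ∫ r : ℤ, ((r : ℝ) ^ 2 - γ) ∂thetaMeasure z = 0 := by
  have := isProbabilityMeasure_thetaMeasure h0.le h1
  have h := (deriv_lgam_eventuallyEq h0 h1 γ).eq_of_nhds
  rw [hz, sub_self, deriv_cgf_zero (zero_mem_interior_integrableExpSet_theta h0 h1 γ)] at h
  simpa [h0.ne'] using h.symm

lemma integral_theta_sq (h0 : 0 < z) (h1 : z < 1) {γ : ℝ} (hz : deriv (lgam γ) z = 0) :
    ∫ r : ℤ, ((r : ℝ) ^ 2 - γ) ^ 2 ∂thetaMeasure z = z ^ 2 * deriv (deriv (lgam γ)) z := by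
  have := isProbabilityMeasure_thetaMeasure h0.le h1
  have hint := zero_mem_interior_integrableExpSet_theta h0 h1 γ
  set K := cgf (fun r : ℤ => (r : ℝ) ^ 2 - γ) (thetaMeasure z)
  have hK0 : deriv K 0 = 0 := by
    rw [deriv_cgf_zero hint, integral_theta_eq_zero h0 h1 hz, zero_div]
  have hK : HasDerivAt (deriv K) (deriv (deriv K) 0) (Real.log z - Real.log z) := by
    rw [sub_self]
    exact (analyticAt_cgf hint).deriv.differentiableAt.hasDerivAt
  have h2 : deriv (deriv K) 0 = ∫ r : ℤ, ((r : ℝ) ^ 2 - γ) ^ 2 ∂thetaMeasure z := by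
    have := iteratedDeriv_two_cgf hint
    rw [iteratedDeriv_succ, iteratedDeriv_one] at this
    rw [this, hK0]
    simp
  have hd := (HasDerivAt.comp z hK ((Real.hasDerivAt_log h0.ne').sub_const (Real.log z))).mul
    (hasDerivAt_inv h0.ne')
  rw [(deriv_lgam_eventuallyEq h0 h1 γ).deriv_eq, ← h2]
  refine (congrArg (z ^ 2 * ·) hd.deriv).trans ?_ |>.symm
  simp only [Function.comp_apply, sub_self, hK0, zero_mul, add_zero]
  field_simp

lemma integral_theta_sq_pos (h0 : 0 < z) (h1 : z < 1) {γ : ℝ} (hγ : γ ≠ 0) :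
    0 < ∫ r : ℤ, ((r : ℝ) ^ 2 - γ) ^ 2 ∂thetaMeasure z := by
  have hint : Integrable (fun r : ℤ => ((r : ℝ) ^ 2 - γ) ^ 2) (thetaMeasure z) :=
    integrable_pow_of_mem_interior_integrableExpSet
      (zero_mem_interior_integrableExpSet_theta h0 h1 γ) 2
  have hnn (r : ℤ) : 0 ≤ thetaWeight z r * ((r : ℝ) ^ 2 - γ) ^ 2 :=
    mul_nonneg (thetaWeight_nonneg h0.le h1 r) (sq_nonneg _)
  rw [integral_thetaMeasure h0.le h1 hint]
  refine Summable.tsum_pos ?_ hnn 0 ?_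
  · exact ((integrable_thetaMeasure_iff h0.le h1).1 hint).of_norm
  · have := jacobiH_pos h0.le h1
    simp only [thetaWeight]
    norm_num
    positivity

end ThetaMeasure

section LocalLimit

lemma tendsto_sqrt_mul_integral_pow {ψ G : ℝ → ℂ} (hψ : Continuous ψ) (hG : Continuous G)
    {c σ : ℝ} (hc : 0 < c) (hσ : 0 < σ)
    (hbound : ∀ θ, |θ| ≤ π → ‖ψ θ‖ ≤ Real.exp (-c * θ ^ 2))
    (hlim : ∀ t : ℝ, Tendsto (fun n : ℕ => ψ ((√n)⁻¹ * t) ^ n) atTop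
      (𝓝 (Complex.exp (-(σ * t) ^ 2 / 2)))) :
    Tendsto (fun n : ℕ => (√n : ℂ) * ∫ θ in (-π)..π, ψ θ ^ n * G θ) atTop
      (𝓝 (G 0 * (√(2 * π) / σ : ℝ))) := by
  obtain ⟨B, hB⟩ := isCompact_Icc.exists_bound_of_continuousOn (s := Icc (-π) π) hG.continuousOn
  have hB0 : 0 ≤ B := (norm_nonneg _).trans (hB 0 ⟨by linarith [pi_pos], pi_pos.le⟩)
  have hscale : Tendsto (fun n : ℕ => (√n)⁻¹) atTop (𝓝 0) :=
    tendsto_inv_atTop_zero.comp (Real.tendsto_sqrt_atTop.comp tendsto_natCast_atTop_atTop)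
  have hgauss : ∫ t : ℝ, Complex.exp (-(σ * t) ^ 2 / 2) * G 0 = G 0 * (√(2 * π) / σ : ℝ) := by
    rw [integral_mul_const, mul_comm]
    congr 1
    have h := integral_gaussian (σ ^ 2 / 2)
    have hs : √(π / (σ ^ 2 / 2)) = √(2 * π) / σ := by
      rw [show π / (σ ^ 2 / 2) = 2 * π / σ ^ 2 by field_simp, Real.sqrt_div (by positivity),
        Real.sqrt_sq hσ.le]
    rw [hs] at h
    rw [← h, ← integral_complex_ofReal]
    congr 1 with t
    push_cast
    ring_nf
  let F (n : ℕ) : ℝ → ℂ := (Ioc (-π) π).indicator fun θ => ψ θ ^ n * G θ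
  have hF (n : ℕ) : Measurable (F n) :=
    ((hψ.pow n).mul hG).measurable.indicator measurableSet_Ioc
  have hchange (n : ℕ) : (√n : ℂ) * ∫ θ in (-π)..π, ψ θ ^ n * G θ = ∫ t, F n ((√n)⁻¹ * t) := by
    rw [Measure.integral_comp_inv_mul_left, abs_of_nonneg (Real.sqrt_nonneg _),
      integral_indicator measurableSet_Ioc, intervalIntegral.integral_of_le (by linarith [pi_pos]),
      Complex.real_smul]
  simp_rw [hchange]
  rw [← hgauss]
  refine tendsto_integral_filter_of_dominated_convergence (fun t => Real.exp (-c * t ^ 2) * B)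
    (.of_forall fun n => ((hF n).comp (by fun_prop)).aestronglyMeasurable) ?_
    ((integrable_exp_neg_mul_sq hc).mul_const B) (.of_forall fun t => ?_)
  · filter_upwards [eventually_gt_atTop 0] with n hn
    refine .of_forall fun t => ?_
    by_cases ht : (√n)⁻¹ * t ∈ Ioc (-π) π
    · have habs : |(√n)⁻¹ * t| ≤ π := abs_le.2 ⟨ht.1.le, ht.2⟩
      simp only [F, indicator_of_mem ht, norm_mul, norm_pow]
      refine mul_le_mul ?_ (hB _ (Ioc_subset_Icc_self ht)) (norm_nonneg _) (Real.exp_nonneg _)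
      refine (pow_le_pow_left₀ (norm_nonneg _) (hbound _ habs) n).trans_eq ?_
      rw [← Real.exp_nat_mul, mul_pow, inv_pow, Real.sq_sqrt n.cast_nonneg]
      congr 1
      field_simp
    · simp only [F, indicator_of_notMem ht, norm_zero]
      positivity
  · have ht0 : Tendsto (fun n : ℕ => (√n)⁻¹ * t) atTop (𝓝 0) := by
      simpa using hscale.mul_const t
    have hlim' := (hlim t).mul ((hG.tendsto 0).comp ht0)
    refine hlim'.congr' ?_
    filter_upwards [ht0 (Ioc_mem_nhds (by linarith [pi_pos] : -π < 0) pi_pos)] with n hn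
    simp only [F, indicator_of_mem (show (√n)⁻¹ * t ∈ Ioc (-π) π from hn), Function.comp_apply]

lemma integral_exp_int_mul (m : ℤ) :
    ∫ θ in (-π)..π, Complex.exp (m * Complex.I * θ) = if m = 0 then 2 * (π : ℂ) else 0 := by
  split_ifs with hm
  · simp [hm]
    ring
  · have hne : (m : ℂ) * Complex.I ≠ 0 := by simp [hm]
    rw [integral_exp_mul_complex hne]
    have : Complex.exp (m * Complex.I * (π : ℝ)) = Complex.exp (m * Complex.I * (-π : ℝ)) := by
      rw [Complex.exp_eq_exp_iff_exists_int]
      exact ⟨m, by push_cast; ring⟩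
    rw [this, sub_self, zero_div]

lemma one_sub_mul_exp_ne_zero {z : ℝ} (h0 : 0 ≤ z) (h1 : z < 1) (θ : ℝ) :
    1 - z * Complex.exp (θ * Complex.I) ≠ 0 := by
  intro h
  have := congrArg norm (sub_eq_zero.1 h)
  rw [norm_mul, Complex.norm_exp_ofReal_mul_I, Complex.norm_real, Real.norm_of_nonneg h0] at this
  simp at this
  linarith

/-- Fourier coefficients of the geometric kernel `1 / (1 - z e^{iθ})`. -/
lemma integral_geometric_kernel {z : ℝ} (h0 : 0 ≤ z) (h1 : z < 1) (n s : ℕ) :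
    ∫ θ in (-π)..π, (1 - z * Complex.exp (θ * Complex.I))⁻¹ *
        Complex.exp (θ * ((s : ℝ) - n : ℝ) * Complex.I) =
      2 * π * if s ≤ n then (z : ℂ) ^ (n - s) else 0 := by
  have hterm (j : ℕ) (θ : ℝ) : (z * Complex.exp (θ * Complex.I)) ^ j *
      Complex.exp (θ * ((s : ℝ) - n : ℝ) * Complex.I) =
        z ^ j * Complex.exp (((j + s - n : ℤ) : ℂ) * Complex.I * θ) := by
    rw [mul_pow, ← Complex.exp_nat_mul, mul_assoc, ← Complex.exp_add]
    congr 2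
    push_cast
    ring
  have hmeas (j : ℕ) : Continuous fun θ : ℝ => (z * Complex.exp (θ * Complex.I)) ^ j *
      Complex.exp (θ * ((s : ℝ) - n : ℝ) * Complex.I) := by fun_prop
  have hgeom (θ : ℝ) : HasSum (fun j : ℕ => (z * Complex.exp (θ * Complex.I)) ^ j)
      (1 - z * Complex.exp (θ * Complex.I))⁻¹ := by
    apply hasSum_geometric_of_norm_lt_one
    rwa [norm_mul, Complex.norm_exp_ofReal_mul_I, Complex.norm_real, Real.norm_of_nonneg h0,
      mul_one]
  have hsum := intervalIntegral.hasSum_integral_of_dominated_convergence (μ := volume)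
    (a := -π) (b := π)
    (F := fun (j : ℕ) (θ : ℝ) => (z * Complex.exp (θ * Complex.I)) ^ j *
      Complex.exp (θ * ((s : ℝ) - n : ℝ) * Complex.I))
    (f := fun θ : ℝ => (1 - z * Complex.exp (θ * Complex.I))⁻¹ *
      Complex.exp (θ * ((s : ℝ) - n : ℝ) * Complex.I))
    (fun j _ => z ^ j) (fun j => (hmeas j).aestronglyMeasurable)
    (fun j => .of_forall fun θ _ => by
      rw [hterm, norm_mul, norm_pow, Complex.norm_real, Real.norm_of_nonneg h0]
      have := Complex.norm_exp_ofReal_mul_I ((j + s - n : ℤ) * θ)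
      push_cast at this ⊢
      rw [mul_right_comm, this, mul_one])
    (.of_forall fun θ _ => summable_geometric_of_lt_one h0 h1) (by simp)
    (.of_forall fun θ _ => (hgeom θ).mul_right _)
  rw [← hsum.tsum_eq]
  simp_rw [hterm, intervalIntegral.integral_const_mul, integral_exp_int_mul]
  split_ifs with hs
  · rw [tsum_eq_single (n - s)]
    · rw [if_pos (by omega)]
      ring
    · intro j hj
      rw [if_neg (by omega), mul_zero]
  · rw [mul_zero]
    refine (tsum_congr fun j => ?_).trans tsum_zero
    rw [if_neg (by omega), mul_zero]

end LocalLimit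

section ThetaCharFun

variable {z : ℝ}

/-- The characteristic function of `r² - γ` under the discrete Gaussian measure. -/
noncomputable def thetaCharFun (γ z : ℝ) : ℝ → ℂ :=
  charFun ((thetaMeasure z).map fun r : ℤ => (r : ℝ) ^ 2 - γ)

lemma thetaCharFun_eq (γ z θ : ℝ) :
    thetaCharFun γ z θ =
      ∫ r : ℤ, Complex.exp (θ * ((r : ℝ) ^ 2 - γ : ℝ) * Complex.I) ∂thetaMeasure z := by
  rw [thetaCharFun, charFun_apply_real, integral_map (by fun_prop) (by fun_prop)]

lemma continuous_thetaCharFun (h0 : 0 < z) (h1 : z < 1) (γ : ℝ) :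
    Continuous (thetaCharFun γ z) := by
  have := isProbabilityMeasure_thetaMeasure h0.le h1
  exact continuous_charFun

lemma tendsto_thetaCharFun_pow (h0 : 0 < z) (h1 : z < 1) {γ σ : ℝ} (hσ : 0 < σ)
    (hmean : ∫ r : ℤ, ((r : ℝ) ^ 2 - γ) ∂thetaMeasure z = 0)
    (hvar : ∫ r : ℤ, ((r : ℝ) ^ 2 - γ) ^ 2 ∂thetaMeasure z = σ ^ 2) (t : ℝ) :
    Tendsto (fun n : ℕ => thetaCharFun γ z ((√n)⁻¹ * t) ^ n) atTop
      (𝓝 (Complex.exp (-(σ * t) ^ 2 / 2))) := by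
  have := isProbabilityMeasure_thetaMeasure h0.le h1
  have h := tendsto_charFun_inv_sqrt_mul_pow (P := thetaMeasure z)
    (X := fun r : ℤ => σ⁻¹ * ((r : ℝ) ^ 2 - γ)) (by fun_prop)
    (by rw [integral_const_mul, hmean, mul_zero])
    (by
      simp only [Pi.pow_apply, mul_pow]
      rw [integral_const_mul, hvar]
      field_simp) (σ * t)
  rw [Complex.ofReal_mul] at h
  refine h.congr fun n => ?_
  rw [thetaCharFun, charFun_map_mul_comp (by fun_prop)]
  congr 2
  field_simp

lemma norm_one_add_exp_mul_I {θ : ℝ} (hθ : |θ| ≤ π) :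
    ‖1 + Complex.exp (θ * Complex.I)‖ = 2 * Real.cos (θ / 2) := by
  have hfac : 1 + Complex.exp (θ * Complex.I) =
      Complex.exp ((θ / 2 : ℝ) * Complex.I) * (2 * Real.cos (θ / 2) : ℝ) := by
    rw [Complex.ofReal_mul, Complex.ofReal_cos, Complex.ofReal_ofNat, Complex.two_cos, mul_add,
      ← Complex.exp_add, ← Complex.exp_add]
    push_cast
    ring_nf
    simp [add_comm]
  have hcos : 0 ≤ Real.cos (θ / 2) := by
    rw [abs_le] at hθ
    exact Real.cos_nonneg_of_neg_pi_div_two_le_of_le (by linarith) (by linarith)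
  rw [hfac, norm_mul, Complex.norm_exp_ofReal_mul_I, one_mul, Complex.norm_real,
    Real.norm_of_nonneg (by positivity)]

lemma norm_thetaCharFun_le (h0 : 0 < z) (h1 : z < 1) (γ : ℝ) {θ : ℝ} (hθ : |θ| ≤ π) :
    ‖thetaCharFun γ z θ‖ ≤ Real.exp (-(z / jacobiH z / π ^ 2) * θ ^ 2) := by
  have := isProbabilityMeasure_thetaMeasure h0.le h1
  have hh := jacobiH_pos h0.le h1
  set q := z / jacobiH z with hq
  set p := 1 / jacobiH z with hp
  have hq0 : 0 < q := by positivity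
  have hqp : q ≤ p := by rw [hq, hp]; gcongr
  set f : ℤ → ℂ := fun r => Complex.exp (θ * ((r : ℝ) ^ 2 - γ : ℝ) * Complex.I) with hf
  have hnorm (r : ℤ) : ‖f r‖ = 1 := by
    simp only [hf]
    rw [← Complex.ofReal_mul, Complex.norm_exp_ofReal_mul_I]
  have hint : Integrable f (thetaMeasure z) :=
    (integrable_const (1 : ℝ)).mono' (by fun_prop) (.of_forall fun r => (hnorm r).le)
  let s : Finset ℤ := {0, 1}
  have hw0 : thetaWeight z 0 = p := by simp [thetaWeight, hp]
  have hw1 : thetaWeight z 1 = q := by simp [thetaWeight, hq]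
  have hs : ‖∫ r in (s : Set ℤ), f r ∂thetaMeasure z‖ ≤ p - q + q * (2 * Real.cos (θ / 2)) := by
    rw [setIntegral_finset s hint.integrableOn, Finset.sum_pair zero_ne_one,
      thetaMeasure_real_singleton h0.le h1, thetaMeasure_real_singleton h0.le h1, hw0, hw1]
    have hfac : p • f 0 + q • f 1 =
        f 0 * ((p - q : ℝ) + (q : ℝ) * (1 + Complex.exp (θ * Complex.I))) := by
      have : f 1 = f 0 * Complex.exp (θ * Complex.I) := by
        simp only [hf]
        rw [← Complex.exp_add]
        congr 1
        push_cast
        ring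
      rw [this, Complex.real_smul, Complex.real_smul]
      push_cast
      ring
    rw [hfac, norm_mul, hnorm, one_mul]
    refine (norm_add_le _ _).trans_eq ?_
    rw [norm_mul, norm_one_add_exp_mul_I hθ, Complex.norm_real, Complex.norm_real,
      Real.norm_of_nonneg hq0.le, Real.norm_of_nonneg (sub_nonneg.2 hqp)]
  have hreal : (thetaMeasure z).real (s : Set ℤ)ᶜ = 1 - (p + q) := by
    rw [probReal_compl_eq_one_sub s.measurableSet, ← sum_measureReal_singleton,
      Finset.sum_pair zero_ne_one, thetaMeasure_real_singleton h0.le h1,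
      thetaMeasure_real_singleton h0.le h1, hw0, hw1]
  have hsc : ‖∫ r in (s : Set ℤ)ᶜ, f r ∂thetaMeasure z‖ ≤ 1 - (p + q) := by
    rw [← hreal, ← one_mul ((thetaMeasure z).real _)]
    exact norm_setIntegral_le_of_norm_le_const (measure_lt_top _ _) fun r _ => (hnorm r).le
  have hcos : Real.cos (θ / 2) ≤ 1 - 2 / π ^ 2 * (θ / 2) ^ 2 :=
    Real.cos_le_one_sub_mul_cos_sq (by rw [abs_div]; norm_num; linarith [pi_pos])
  calc ‖thetaCharFun γ z θ‖
      = ‖(∫ r in (s : Set ℤ), f r ∂thetaMeasure z) + ∫ r in (s : Set ℤ)ᶜ, f r ∂thetaMeasure z‖ := by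
        rw [integral_add_compl s.measurableSet hint, thetaCharFun_eq]
    _ ≤ (p - q + q * (2 * Real.cos (θ / 2))) + (1 - (p + q)) :=
        (norm_add_le _ _).trans (add_le_add hs hsc)
    _ ≤ (p - q + q * (2 * (1 - 2 / π ^ 2 * (θ / 2) ^ 2))) + (1 - (p + q)) := by gcongr
    _ = -(q / π ^ 2) * θ ^ 2 + 1 := by ring
    _ ≤ Real.exp (-(q / π ^ 2) * θ ^ 2) := Real.add_one_le_exp _

end ThetaCharFun

section Counting

variable {z : ℝ}

lemma finite_setOf_sum_sq_le (D n : ℕ) : {k : Fin D → ℤ | ∑ i, (k i ^ 2).toNat ≤ n}.Finite := by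
  refine (Set.Finite.pi' fun _ : Fin D => Set.finite_Icc (-(n : ℤ)) n).subset fun k hk i => ?_
  have h1 : (k i ^ 2).toNat ≤ n :=
    (Finset.single_le_sum (f := fun i => (k i ^ 2).toNat) (fun _ _ => Nat.zero_le _)
      (Finset.mem_univ i)).trans hk
  have h2 : k i ^ 2 ≤ n := Int.toNat_le.1 h1
  constructor <;> nlinarith [Int.le_self_sq (k i), Int.le_self_sq (-(k i))]

lemma N2_succ_eq {D n : ℕ} {γ : ℝ} (hn : γ * (D + 1 : ℕ) = n) :
    N2 (D + 1) γ = {k : Fin D → ℤ | ∑ i, (k i ^ 2).toNat ≤ n}.ncard := by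
  rw [N2, ← Set.ncard_image_of_injective _
    (Fin.cons_right_injective (α := fun _ : Fin (D + 1) => ℤ) 0)]
  congr 1
  ext k
  have hsum : (∑ i, ((k i : ℝ)) ^ 2 ≤ γ * (D + 1 : ℕ)) ↔ ∑ i, (k i ^ 2).toNat ≤ n := by
    rw [hn]
    simp_rw [sq_eq_natCast_toNat]
    exact_mod_cast Iff.rfl
  simp only [mem_ofPred_eq, hsum, mem_image]
  constructor
  · rintro ⟨hk0, hk⟩
    refine ⟨Fin.tail k, ?_, ?_⟩
    · rw [Fin.sum_univ_succ] at hk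
      exact le_of_add_le_right hk
    · conv_rhs => rw [← Fin.cons_self_tail k, hk0 0 rfl]
  · rintro ⟨k, hk, rfl⟩
    refine ⟨fun i hi => ?_, ?_⟩
    · rw [show i = 0 from Fin.ext hi, Fin.cons_zero]
    · simpa [Fin.sum_univ_succ] using hk

lemma integral_pi_thetaMeasure (h0 : 0 < z) (h1 : z < 1) (D n : ℕ) :
    ∫ k : Fin D → ℤ, (if ∑ i, (k i ^ 2).toNat ≤ n then (z : ℂ) ^ (n - ∑ i, (k i ^ 2).toNat) else 0)
        ∂Measure.pi (fun _ => thetaMeasure z) =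
      ({k : Fin D → ℤ | ∑ i, (k i ^ 2).toNat ≤ n}.ncard : ℂ) * (z ^ n / jacobiH z ^ D) := by
  have := isProbabilityMeasure_thetaMeasure h0.le h1
  have hfin := finite_setOf_sum_sq_le D n
  set A := {k : Fin D → ℤ | ∑ i, (k i ^ 2).toNat ≤ n} with hA
  have hind : (fun k : Fin D → ℤ => if ∑ i, (k i ^ 2).toNat ≤ n then
      (z : ℂ) ^ (n - ∑ i, (k i ^ 2).toNat) else 0) =
      A.indicator fun k => (z : ℂ) ^ (n - ∑ i, (k i ^ 2).toNat) := by
    ext k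
    simp [Set.indicator, hA]
  rw [hind, integral_indicator hfin.measurableSet, ← hfin.coe_toFinset,
    setIntegral_finset _ IntegrableOn.finset,
    Set.ncard_coe_finset, ← nsmul_eq_mul, ← Finset.sum_const]
  refine Finset.sum_congr rfl fun k hk => ?_
  have hk' : ∑ i, (k i ^ 2).toNat ≤ n := hfin.mem_toFinset.1 hk
  have hreal : (Measure.pi fun _ => thetaMeasure z).real {k} =
      z ^ (∑ i, (k i ^ 2).toNat) / jacobiH z ^ D := by
    rw [Measure.real, Measure.pi_singleton, ENNReal.toReal_prod]
    have (i : Fin D) : (thetaMeasure z {k i}).toReal = thetaWeight z (k i) :=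
      thetaMeasure_real_singleton h0.le h1 (k i)
    simp_rw [this, thetaWeight]
    rw [Finset.prod_div_distrib, Finset.prod_pow_eq_pow_sum, Finset.prod_const, Finset.card_univ,
      Fintype.card_fin]
  rw [hreal, Complex.real_smul]
  push_cast
  rw [div_mul_eq_mul_div, ← pow_add, Nat.add_sub_cancel' hk']

/-- Cauchy's formula for the generating function `h(x) ^ D / (1 - x)` on the circle `|x| = z`. -/
lemma N2_succ_eq_integral (h0 : 0 < z) (h1 : z < 1) {D n : ℕ} {γ : ℝ}
    (hn : γ * (D + 1 : ℕ) = n) :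
    2 * π * ((N2 (D + 1) γ : ℂ) * (z ^ n / jacobiH z ^ D)) =
      ∫ θ in (-π)..π, thetaCharFun γ z θ ^ D *
        ((1 - z * Complex.exp (θ * Complex.I))⁻¹ * Complex.exp ((-(γ * θ) : ℝ) * Complex.I)) := by
  have := isProbabilityMeasure_thetaMeasure h0.le h1
  let S (k : Fin D → ℤ) : ℕ := ∑ i, (k i ^ 2).toNat
  have hkernel : Continuous fun θ : ℝ => (1 - z * Complex.exp (θ * Complex.I))⁻¹ :=
    Continuous.inv₀ (by fun_prop) (one_sub_mul_exp_ne_zero h0.le h1)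
  have hprod (θ : ℝ) : thetaCharFun γ z θ ^ D *
        ((1 - z * Complex.exp (θ * Complex.I))⁻¹ * Complex.exp ((-(γ * θ) : ℝ) * Complex.I)) =
      ∫ k, (1 - z * Complex.exp (θ * Complex.I))⁻¹ *
        Complex.exp (θ * ((S k : ℝ) - n : ℝ) * Complex.I)
        ∂Measure.pi (fun _ : Fin D => thetaMeasure z) := by
    have hpow := integral_fintype_prod_eq_pow (ι := Fin D) (μ := thetaMeasure z)
      (fun r : ℤ => Complex.exp (θ * ((r : ℝ) ^ 2 - γ : ℝ) * Complex.I))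
    rw [Fintype.card_fin] at hpow
    rw [thetaCharFun_eq, ← hpow, ← integral_mul_const]
    congr 1 with k
    rw [mul_left_comm, ← Complex.exp_sum, ← Complex.exp_add, ← hn]
    congr 2
    simp_rw [sq_eq_natCast_toNat, ← Finset.sum_mul, ← Finset.mul_sum, ← Complex.ofReal_sum,
      Finset.sum_sub_distrib, S]
    simp
    ring
  rw [N2_succ_eq hn, ← integral_pi_thetaMeasure h0 h1, ← integral_const_mul]
  simp_rw [hprod]
  rw [intervalIntegral_integral_swap]
  · congr 1 with k
    exact (integral_geometric_kernel h0.le h1 n (S k)).symm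
  · obtain ⟨B, hB⟩ := isCompact_Icc.exists_bound_of_continuousOn (s := Icc (-π) π)
      hkernel.continuousOn
    have hmeas : Measurable (Function.uncurry fun (θ : ℝ) (k : Fin D → ℤ) =>
        (1 - z * Complex.exp (θ * Complex.I))⁻¹ *
          Complex.exp (θ * ((S k : ℝ) - n : ℝ) * Complex.I)) := by
      have hS : Measurable fun k : Fin D → ℤ => (S k : ℝ) := measurable_of_countable _
      exact (hkernel.measurable.comp measurable_fst).mul (by fun_prop)
    have : IsFiniteMeasure ((volume : Measure ℝ).restrict (uIoc (-π) π)) :=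
      ⟨by simp [uIoc]⟩
    refine Integrable.of_bound hmeas.aestronglyMeasurable B ?_
    rw [uIoc_of_le (by linarith [pi_pos]), ← Measure.restrict_univ (μ := Measure.pi _),
      Measure.prod_restrict]
    refine ae_restrict_of_forall_mem (measurableSet_Ioc.prod .univ) fun x hx => ?_
    have hexp := Complex.norm_exp_ofReal_mul_I (x.1 * ((S x.2 : ℝ) - n))
    rw [Complex.ofReal_mul] at hexp
    simp only [Function.uncurry, norm_mul]
    rw [hexp, mul_one]
    exact hB _ (Ioc_subset_Icc_self hx.1)

end Counting

/-- For a positive rational `γ`, with `z_γ ∈ (0,1)` the unique root of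
`l_γ'`, as `d → ∞` along integers with `γ d ∈ ℤ`,
`N₂(d,γ) (z_γ^γ / h(z_γ))^d h(z_γ) z_γ (1 − z_γ) √(2 l_γ''(z_γ) π d) → 1`. -/
theorem N2_asymptotics (γ : ℚ) (hγ : 0 < γ) (zγ : ℝ)
    (hzγ : zγ ∈ Set.Ioo (0 : ℝ) 1 ∧ deriv (lgam (γ : ℝ)) zγ = 0)
    (huniq : ∀ z : ℝ, z ∈ Set.Ioo (0 : ℝ) 1 ∧ deriv (lgam (γ : ℝ)) z = 0 → z = zγ) :
    Filter.Tendsto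
      (fun d : ℕ => (N2 d (γ : ℝ) : ℝ) * (zγ ^ (γ : ℝ) / jacobiH zγ) ^ d *
        (jacobiH zγ * zγ * (1 - zγ) *
          Real.sqrt (2 * deriv (deriv (lgam (γ : ℝ))) zγ * Real.pi * d)))
      (alongIntMultiples γ) (nhds 1) := by
  obtain ⟨⟨h0, h1⟩, hz⟩ := hzγ
  have hh := jacobiH_pos h0.le h1
  have hγ' : (0 : ℝ) < γ := by exact_mod_cast hγ
  set L := deriv (deriv (lgam (γ : ℝ))) zγ
  have hvar := integral_theta_sq h0 h1 hz
  have hL : 0 < L := by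
    have := hvar ▸ integral_theta_sq_pos h0 h1 hγ'.ne'
    exact pos_of_mul_pos_right this (sq_nonneg _)
  set σ := zγ * √L with hσdef
  have hσ : 0 < σ := by positivity
  have hvar' : ∫ r : ℤ, ((r : ℝ) ^ 2 - γ) ^ 2 ∂thetaMeasure zγ = σ ^ 2 := by
    rw [hvar, hσdef, mul_pow, Real.sq_sqrt hL.le]
  let G (θ : ℝ) : ℂ :=
    (1 - zγ * Complex.exp (θ * Complex.I))⁻¹ * Complex.exp ((-(γ * θ) : ℝ) * Complex.I)
  have hG : Continuous G :=
    (Continuous.inv₀ (by fun_prop) (one_sub_mul_exp_ne_zero h0.le h1)).mul (by fun_prop)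
  have hG0 : G 0 = ((1 - zγ)⁻¹ : ℝ) := by simp [G]
  have hlocal := tendsto_sqrt_mul_integral_pow (continuous_thetaCharFun h0 h1 γ) hG
    (by positivity : 0 < zγ / jacobiH zγ / π ^ 2) hσ
    (fun θ hθ => norm_thetaCharFun_le h0 h1 γ hθ)
    (tendsto_thetaCharFun_pow h0 h1 hσ (integral_theta_eq_zero h0 h1 hz) hvar')
  rw [hG0, ← Complex.ofReal_mul] at hlocal
  have hratio : Tendsto (fun D : ℕ => √((D + 1 : ℕ) / D : ℝ)) atTop (𝓝 1) := by
    have : Tendsto (fun D : ℕ => ((D + 1 : ℕ) / D : ℝ)) atTop (𝓝 1) := by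
      have := tendsto_one_div_atTop_nhds_zero_nat (𝕜 := ℝ) |>.const_add 1
      rw [add_zero] at this
      refine this.congr' ?_
      filter_upwards [eventually_ne_atTop 0] with D hD
      have : (D : ℝ) ≠ 0 := by exact_mod_cast hD
      push_cast
      field_simp
    simpa using this.sqrt
  have hlim := ((Complex.continuous_re.tendsto _).comp hlocal).mul hratio |>.const_mul
    ((1 - zγ) * σ * √(2 * π) / (2 * π)) |>.comp (tendsto_sub_atTop_nat 1)
  have hone : (1 - zγ) * σ * √(2 * π) / (2 * π) *
      (((((1 - zγ)⁻¹ * (√(2 * π) / σ) : ℝ) : ℂ).re) * 1) = 1 := by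
    have hs : √(2 * π) * √(2 * π) = 2 * π := Real.mul_self_sqrt (by positivity)
    have h1z : 1 - zγ ≠ 0 := (sub_pos.2 h1).ne'
    rw [Complex.ofReal_re]
    field_simp
    rw [sq, hs]
  rw [hone] at hlim
  refine (hlim.mono_left inf_le_left).congr' ?_
  refine eventually_inf_principal.2 ?_
  filter_upwards [eventually_gt_atTop 1] with d hd ⟨m, hm⟩
  obtain ⟨D, rfl⟩ : ∃ D, d = D + 1 := ⟨d - 1, by omega⟩
  have hD : (0 : ℝ) < D := by exact_mod_cast (by omega : 0 < D)
  have hm0 : (0 : ℝ) ≤ m := hm ▸ by positivity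
  lift m to ℕ using by exact_mod_cast hm0
  have hn : (γ : ℝ) * (D + 1 : ℕ) = m := by exact_mod_cast hm
  have hcauchy := N2_succ_eq_integral h0 h1 hn
  simp only [Function.comp_apply, Nat.add_sub_cancel]
  change _ * ((((√D : ℝ) : ℂ) * ∫ θ in (-π)..π, thetaCharFun γ zγ θ ^ D * G θ).re * _) = _
  rw [← hcauchy]
  have hre : (((√D : ℝ) : ℂ) * (2 * π * ((N2 (D + 1) γ : ℂ) * (zγ ^ m / jacobiH zγ ^ D)))).re =
      √D * (2 * π * ((N2 (D + 1) γ : ℝ) * (zγ ^ m / jacobiH zγ ^ D))) := by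
    rw [← Complex.ofReal_re (√D * _)]
    push_cast
    rfl
  have hpow : (zγ ^ (γ : ℝ)) ^ (D + 1) = zγ ^ m := by
    rw [← Real.rpow_natCast, ← Real.rpow_mul h0.le, hn, Real.rpow_natCast]
  have hsqrt : √(2 * L * π * (D + 1 : ℕ)) = √L * √(2 * π) * √((D + 1 : ℕ) : ℝ) := by
    rw [← Real.sqrt_mul hL.le, ← Real.sqrt_mul (by positivity)]
    ring_nf
  rw [hre, div_pow, hpow, hsqrt, Real.sqrt_div (by positivity), hσdef]
  have : √(D : ℝ) ≠ 0 := (Real.sqrt_pos.2 hD).ne'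
  field_simp
  rw [pow_succ, mul_assoc]
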